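/- arXiv:2502.02325 — 2 statements merged into one kernel-verified Lean document; each statement's English description precedes it below -/
import Mathlib

section
/- There exists a constant C > 0 such that for all real numbers a and b, (1 + |a|)·|a/√(1 + a²) − b/√(1 + b²)| ≤ C·|a − b|. That is, the divided differences of the function F(x) = x(1 + x²)^{-1/2} satisfy the weighted uniform bound (1 + |a|)·|F(a) − F(b)|/|a − b| ≤ C for all a ≠ b. -/
/-- There is a constant `C > 0` such that for all real `a, b`,
`(1 + |a|)·|a/√(1 + a²) − b/√(1 + b²)| ≤ C·|a − b|`. -/
theorem weighted_divided_difference_bound :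
    ∃ C : ℝ, 0 < C ∧ ∀ a b : ℝ,
      (1 + |a|) * |a / Real.sqrt (1 + a ^ 2) - b / Real.sqrt (1 + b ^ 2)| ≤
        C * |a - b| := by
  refine ⟨4, by norm_num, fun a b => ?_⟩
  have hs : 0 < Real.sqrt (1 + a ^ 2) := Real.sqrt_pos.2 (by positivity)
  have ht : 0 < Real.sqrt (1 + b ^ 2) := Real.sqrt_pos.2 (by positivity)
  have hs2 := Real.sq_sqrt (show 0 ≤ 1 + a ^ 2 by positivity)
  have ht2 := Real.sq_sqrt (show 0 ≤ 1 + b ^ 2 by positivity)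
  generalize Real.sqrt (1 + a ^ 2) = s at *
  generalize Real.sqrt (1 + b ^ 2) = t at *
  have h1 : 1 ≤ s := by nlinarith [sq_nonneg a]
  have h2 : |a| ≤ s := abs_le_of_sq_le_sq (by linarith) hs.le
  have h3 : |b| ≤ t := abs_le_of_sq_le_sq (by linarith) ht.le
  have h4 : 1 + a * b ≤ s * t := by
    have h : (s * t) ^ 2 = (1 + a ^ 2) * (1 + b ^ 2) := by rw [mul_pow, hs2, ht2]
    have hst := mul_pos hs ht
    by_contra hc
    push Not at hc
    nlinarith [sq_nonneg (a - b)]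
  have h5 : |t - s| ≤ |a - b| := sq_le_sq.1 (by nlinarith)
  have h6 : |a * t - b * s| ≤ 2 * t * |a - b| := by
    calc |a * t - b * s| = |(a - b) * t + b * (t - s)| := by congr 1; ring
      _ ≤ |(a - b) * t| + |b * (t - s)| := abs_add_le _ _
      _ = |a - b| * t + |b| * |t - s| := by rw [abs_mul, abs_mul, abs_of_pos ht]
      _ ≤ |a - b| * t + t * |a - b| := by gcongr
      _ = 2 * t * |a - b| := by ring
  rw [div_sub_div _ _ hs.ne' ht.ne', abs_div, abs_of_pos (mul_pos hs ht), mul_div_assoc',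
    div_le_iff₀ (mul_pos hs ht)]
  calc (1 + |a|) * |a * t - s * b| ≤ (2 * s) * (2 * t * |a - b|) := by
        rw [mul_comm s b]
        gcongr
        linarith
    _ = 4 * |a - b| * (s * t) := by ring
end

section
/- Let d ≥ 1 be an integer and T > 0. For every smooth compactly supported function f : ℝᵈ → ℝ satisfying the orthogonality condition ∫_{ℝᵈ} f(Z)·exp(−T‖Z‖²/2) dZ = 0, one has ∫_{ℝᵈ} (‖∇f(Z)‖² + T²·‖Z‖²·f(Z)²) dZ ≥ (d + 2)·T·∫_{ℝᵈ} f(Z)² dZ. -/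
open MeasureTheory

set_option linter.unusedSectionVars false

namespace HOGap

variable {E : Type*} [NormedAddCommGroup E] [InnerProductSpace ℝ E] [FiniteDimensional ℝ E]
  [MeasurableSpace E] [BorelSpace E]

/-- Gaussian weight -/
noncomputable def w (T : ℝ) (x : E) : ℝ := Real.exp (-T * ‖x‖ ^ 2)

lemma w_pos (T : ℝ) (x : E) : 0 < w T x := Real.exp_pos _

lemma w_contDiff (T : ℝ) : ContDiff ℝ 1 (w T : E → ℝ) := by
  unfold w
  exact (contDiff_const.mul (contDiff_norm_sq ℝ)).exp

lemma w_cont (T : ℝ) : Continuous (w T : E → ℝ) := (w_contDiff T).continuous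

lemma w_hasFDerivAt (T : ℝ) (x : E) :
    HasFDerivAt (w T : E → ℝ) ((-2 * T * w T x) • (innerSL ℝ x)) x := by
  have h := (((hasStrictFDerivAt_norm_sq x).hasFDerivAt).const_mul (-T)).exp
  unfold w
  convert h using 1
  ext v
  simp
  ring

lemma w_int {T : ℝ} (hT : 0 < T) : Integrable (w T : E → ℝ) := by
  have h := GaussianFourier.integrable_cexp_neg_mul_sq_norm_add (V := E) (b := (T : ℂ))
    (by simpa using hT) 0 0
  have h2 := h.re
  refine h2.congr (Filter.Eventually.of_forall fun x => ?_)
  have : (-(T : ℂ) * (‖x‖ : ℂ) ^ 2 + 0 * ((inner ℝ (0 : E) x : ℝ) : ℂ))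
    = ((-T * ‖x‖ ^ 2 : ℝ) : ℂ) := by push_cast; ring
  simp only [this, w]
  exact Complex.exp_ofReal_re _

/-- weight with linear growth -/
noncomputable def K (T : ℝ) (x : E) : ℝ := (1 + ‖x‖) * w T x

lemma K_int {T : ℝ} (hT : 0 < T) : Integrable (K T : E → ℝ) := by
  refine ((w_int (E := E) (half_pos hT)).const_mul (2 + 2 / T)).mono'
    (((continuous_const.add continuous_norm).mul (w_cont T)).aestronglyMeasurable)
    (Filter.Eventually.of_forall fun x => ?_)
  have h0 : 0 ≤ K T x := mul_nonneg (by positivity) (w_pos T x).le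
  rw [Real.norm_of_nonneg h0]
  have e : w T x = w (T / 2) x * Real.exp (-(T / 2 * ‖x‖ ^ 2)) := by
    unfold w; rw [← Real.exp_add]; congr 1; ring
  have h1 := Real.add_one_le_exp (T / 2 * ‖x‖ ^ 2)
  have h2 : 1 + ‖x‖ ≤ (2 + 2 / T) * Real.exp (T / 2 * ‖x‖ ^ 2) := by
    have : (2 + 2 / T) * (T / 2 * ‖x‖ ^ 2 + 1) ≤ (2 + 2 / T) * Real.exp (T / 2 * ‖x‖ ^ 2) := by
      gcongr
    refine le_trans ?_ this
    have : (2 + 2 / T) * (T / 2 * ‖x‖ ^ 2 + 1) = T * ‖x‖ ^ 2 + ‖x‖ ^ 2 + 2 + 2 / T := by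
      field_simp; ring
    rw [this]
    have : 0 < 2 / T := by positivity
    nlinarith [sq_nonneg (‖x‖ - 1), mul_nonneg hT.le (sq_nonneg ‖x‖)]
  unfold K
  calc (1 + ‖x‖) * w T x ≤ ((2 + 2 / T) * Real.exp (T / 2 * ‖x‖ ^ 2)) * w T x :=
        mul_le_mul_of_nonneg_right h2 (w_pos T x).le
    _ = (2 + 2 / T) * w (T / 2) x := by
        rw [e, mul_mul_mul_comm, Real.exp_neg]
        field_simp

lemma int1 {T : ℝ} (hT : 0 < T) {F : E → ℝ} (hF : Continuous F) (C : ℝ)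
    (hb : ∀ x, |F x| ≤ C * (1 + ‖x‖)) : Integrable (fun x => F x * w T x) := by
  refine ((K_int (E := E) hT).const_mul C).mono' (hF.mul (w_cont T)).aestronglyMeasurable
    (Filter.Eventually.of_forall fun x => ?_)
  rw [Real.norm_eq_abs, abs_mul, abs_of_pos (w_pos T x), K, ← mul_assoc]
  exact mul_le_mul_of_nonneg_right (hb x) (w_pos T x).le

lemma K2_int {T : ℝ} (hT : 0 < T) (C : ℝ) :
    Integrable (fun p : E × E => C * (K T p.1 * K T p.2)) :=
  ((K_int hT).mul_prod (K_int hT)).const_mul C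

lemma bd2 {T : ℝ} {a : ℝ} {p : E × E} {C : ℝ}
    (hb : |a| ≤ C * ((1 + ‖p.1‖) * (1 + ‖p.2‖))) :
    ‖a * (w T p.1 * w T p.2)‖ ≤ C * (K T p.1 * K T p.2) := by
  have := mul_pos (w_pos T p.1) (w_pos T p.2)
  rw [Real.norm_eq_abs, abs_mul, abs_of_pos this, K, K]
  calc _ ≤ _ := mul_le_mul_of_nonneg_right hb this.le
    _ = _ := by ring

lemma int2 {T : ℝ} (hT : 0 < T) {F : E × E → ℝ} (hF : Continuous F) (C : ℝ)
    (hb : ∀ p, |F p| ≤ C * ((1 + ‖p.1‖) * (1 + ‖p.2‖))) :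
    Integrable (fun p => F p * (w T p.1 * w T p.2)) := by
  refine (K2_int (E := E) hT C).mono' ?_
    (Filter.Eventually.of_forall fun p => bd2 (hb p))
  exact (hF.mul (((w_cont T).comp continuous_fst).mul
    ((w_cont T).comp continuous_snd))).aestronglyMeasurable

lemma rot_norm (θ : ℝ) (x y : E) : ‖Real.cos θ • x + Real.sin θ • y‖ ^ 2 +
    ‖-Real.sin θ • x + Real.cos θ • y‖ ^ 2 = ‖x‖ ^ 2 + ‖y‖ ^ 2 := by
  simp only [← real_inner_self_eq_norm_sq, inner_add_left, inner_add_right, inner_smul_left,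
      inner_smul_right, conj_trivial, real_inner_comm x y]
  linear_combination (inner ℝ x x + inner ℝ y y) * (Real.sin_sq_add_cos_sq θ)

/-- rotation -/
noncomputable def rotL (θ : ℝ) : WithLp 2 (E × E) →ₗᵢ[ℝ] WithLp 2 (E × E) where
  toFun p := WithLp.toLp 2 (Real.cos θ • p.fst + Real.sin θ • p.snd,
    -Real.sin θ • p.fst + Real.cos θ • p.snd)
  map_add' x y := by
    apply WithLp.ofLp_injective
    ext <;> simp <;> module
  map_smul' c x := by
    apply WithLp.ofLp_injective
    ext <;> simp <;> module
  norm_map' p := by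
    rw [← sq_eq_sq₀ (norm_nonneg _) (norm_nonneg _)]
    simp only [WithLp.prod_norm_sq_eq_of_L2, LinearMap.coe_mk, AddHom.coe_mk]
    exact rot_norm θ p.fst p.snd

lemma rot_w (T θ : ℝ) (x y : E) : w T (Real.cos θ • x + Real.sin θ • y) *
    w T (-Real.sin θ • x + Real.cos θ • y) = w T x * w T y := by
  unfold w
  rw [← Real.exp_add, ← Real.exp_add, ← mul_add, ← mul_add, rot_norm]

lemma rot_int (θ : ℝ) (Φ : E × E → ℝ) :
    ∫ p : E × E, Φ (Real.cos θ • p.1 + Real.sin θ • p.2,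
      -Real.sin θ • p.1 + Real.cos θ • p.2) = ∫ p, Φ p := by
  let e := (rotL (E := E) θ).toLinearIsometryEquiv rfl
  have h1 := (WithLp.volume_preserving_symm_measurableEquiv_toLp_prod E E)
  have := ((h1.symm.trans (e := _) (e' := e.toMeasurableEquiv)
    e.measurePreserving).trans h1).integral_comp' Φ
  exact this

lemma ibp {T : ℝ} (hT : 0 < T) {h : E → ℝ} (hh : ContDiff ℝ 1 h) (C : ℝ)
    (hC : ∀ x, |h x| ≤ C) (hC' : ∀ x, ‖fderiv ℝ h x‖ ≤ C) (p : E) :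
    ∫ v, h v * inner ℝ p v * w T v = (1 / (2 * T)) * ∫ v, fderiv ℝ h v p * w T v := by
  have hC0 : 0 ≤ C := (abs_nonneg _).trans (hC 0)
  have fw : ∀ v, fderiv ℝ (w T : E → ℝ) v p = -2 * T * w T v * inner ℝ p v := by
    intro v
    rw [(w_hasFDerivAt T v).fderiv]
    simp [real_inner_comm]
  have cfd : Continuous fun v => fderiv ℝ h v p :=
    (hh.continuous_fderiv one_ne_zero).clm_apply continuous_const
  have i1 : Integrable (fun v => h v * inner ℝ p v * w T v) := by
    refine int1 hT (hh.continuous.mul (by fun_prop)) (C * ‖p‖) fun x => ?_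
    rw [abs_mul]
    have h1 := abs_real_inner_le_norm p x
    calc |h x| * |inner ℝ p x| ≤ C * (‖p‖ * ‖x‖) := by gcongr; exact hC x
      _ ≤ C * (‖p‖ * (1 + ‖x‖)) := by gcongr; linarith
      _ = _ := by ring
  have i2 : Integrable (fun v => fderiv ℝ h v p * w T v) := by
    refine int1 hT cfd (C * ‖p‖) fun x => ?_
    have h1 := (fderiv ℝ h x).le_opNorm p
    rw [Real.norm_eq_abs] at h1
    calc _ ≤ _ := h1
      _ ≤ C * ‖p‖ * 1 := by rw [mul_one]; gcongr; exact hC' x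
      _ ≤ _ := by gcongr; linarith [norm_nonneg x]
  have i3 : Integrable (fun v => h v * w T v) := by
    refine int1 hT hh.continuous C fun x => ?_
    calc _ ≤ C * 1 := by rw [mul_one]; exact hC x
      _ ≤ _ := by gcongr; linarith [norm_nonneg x]
  have e : ∀ v, h v * fderiv ℝ (w T : E → ℝ) v p = (-2 * T) * (h v * inner ℝ p v * w T v) := by
    intro v; rw [fw]; ring
  have key := integral_mul_fderiv_eq_neg_fderiv_mul_of_integrable (μ := (volume : Measure E))
    (f := h) (g := w T) (v := p) i2 (by simp only [e]; exact i1.const_mul _) i3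
    (fun x _ => (hh.differentiable one_ne_zero) x)
    (fun x _ => (w_hasFDerivAt T x).differentiableAt)
  simp only [e] at key
  rw [integral_const_mul] at key
  field_simp
  linarith

lemma W_pos {T : ℝ} (hT : 0 < T) : 0 < ∫ x : E, w T x := by
  have := GaussianFourier.integral_rexp_neg_mul_sq_norm (V := E) hT
  unfold w
  rw [this]
  positivity

lemma fderiv_eq (g : E → ℝ) (hg : ContDiff ℝ 1 g) (x v : E) :
    fderiv ℝ g x v = inner ℝ (gradient g x) v := by
  simp [gradient]

lemma grad_cont (g : E → ℝ) (hg : ContDiff ℝ 1 g) : Continuous (gradient g) := by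
  unfold gradient
  exact (LinearIsometryEquiv.continuous _).comp (hg.continuous_fderiv one_ne_zero)

lemma grad_supp (g : E → ℝ) (hs : HasCompactSupport g) : HasCompactSupport (gradient g) := by
  unfold gradient
  exact (hs.fderiv (𝕜 := ℝ)).comp_left (g := (InnerProductSpace.toDual ℝ E).symm) (map_zero _)

lemma norm_rot1 (θ : ℝ) (x y : E) : ‖-Real.sin θ • x + Real.cos θ • y‖ ≤ ‖x‖ + ‖y‖ := by
  have h1 : ‖-Real.sin θ • x‖ ≤ ‖x‖ := by
    rw [norm_smul, norm_neg]
    exact mul_le_of_le_one_left (norm_nonneg _) (Real.abs_sin_le_one θ)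
  have h2 : ‖Real.cos θ • y‖ ≤ ‖y‖ := by
    rw [norm_smul]
    exact mul_le_of_le_one_left (norm_nonneg _) (Real.abs_cos_le_one θ)
  exact (norm_add_le _ _).trans (add_le_add h1 h2)

/-- interpolation function -/
noncomputable def G (T : ℝ) (g : E → ℝ) (θ : ℝ) : ℝ :=
  ∫ p : E × E, (g p.1 * g (Real.cos θ • p.1 + Real.sin θ • p.2)) * (w T p.1 * w T p.2)

noncomputable def G' (T : ℝ) (g : E → ℝ) (θ : ℝ) : ℝ :=
  ∫ p : E × E, (g p.1 * inner ℝ (gradient g (Real.cos θ • p.1 + Real.sin θ • p.2))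
    (-Real.sin θ • p.1 + Real.cos θ • p.2)) * (w T p.1 * w T p.2)

lemma one_le_bd {x y : E} {C : ℝ} (hC : 0 ≤ C) : C ≤ C * ((1 + ‖x‖) * (1 + ‖y‖)) := by
  have : 1 ≤ (1 + ‖x‖) * (1 + ‖y‖) := by nlinarith [norm_nonneg x, norm_nonneg y, mul_nonneg (norm_nonneg x) (norm_nonneg y)]
  nlinarith

lemma G_deriv {T : ℝ} (hT : 0 < T) {g : E → ℝ} (hg : ContDiff ℝ 1 g) (C : ℝ)
    (hC : ∀ x, |g x| ≤ C) (hC' : ∀ x, ‖gradient g x‖ ≤ C) (θ : ℝ) :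
    HasDerivAt (G T g) (G' T g θ) θ := by
  have hC0 : 0 ≤ C := (abs_nonneg _).trans (hC 0)
  have gc := hg.continuous
  have Dc := grad_cont g hg
  have wc := w_cont (E := E) T
  refine (hasDerivAt_integral_of_dominated_loc_of_deriv_le (μ := (volume : Measure (E × E)))
    (s := Set.univ) (x₀ := θ)
    (F := fun θ p => (g p.1 * g (Real.cos θ • p.1 + Real.sin θ • p.2)) * (w T p.1 * w T p.2))
    (F' := fun θ p => (g p.1 * inner ℝ (gradient g (Real.cos θ • p.1 + Real.sin θ • p.2))
    (-Real.sin θ • p.1 + Real.cos θ • p.2)) * (w T p.1 * w T p.2))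
    (bound := fun p => (C * C) * (K T p.1 * K T p.2))
    Filter.univ_mem ?_ ?_ ?_ ?_ (K2_int hT _) ?_).2
  · refine Filter.Eventually.of_forall fun t => Continuous.aestronglyMeasurable ?_
    fun_prop
  · refine int2 hT (by fun_prop) (C * C) fun p => ?_
    refine le_trans ?_ (one_le_bd (mul_nonneg hC0 hC0))
    rw [abs_mul]
    exact mul_le_mul (hC _) (hC _) (abs_nonneg _) hC0
  · refine Continuous.aestronglyMeasurable ?_
    fun_prop
  · refine Filter.Eventually.of_forall fun p t _ => bd2 ?_
    rw [abs_mul]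
    have h1 := abs_real_inner_le_norm (gradient g (Real.cos t • p.1 + Real.sin t • p.2))
      (-Real.sin t • p.1 + Real.cos t • p.2)
    have h2 := norm_rot1 t p.1 p.2
    have h3 := hC' (Real.cos t • p.1 + Real.sin t • p.2)
    calc _ ≤ C * (C * (‖p.1‖ + ‖p.2‖)) := by
          refine mul_le_mul (hC _) (h1.trans ?_) (abs_nonneg _) hC0
          exact mul_le_mul h3 h2 (norm_nonneg _) hC0
      _ = (C * C) * (‖p.1‖ + ‖p.2‖) := by ring
      _ ≤ _ := by
          gcongr
          nlinarith [mul_nonneg (norm_nonneg p.1) (norm_nonneg p.2)]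
  · refine Filter.Eventually.of_forall fun p t _ => ?_
    have h1 : HasDerivAt (fun t : ℝ => Real.cos t • p.1 + Real.sin t • p.2)
        (-Real.sin t • p.1 + Real.cos t • p.2) t :=
      ((Real.hasDerivAt_cos t).smul_const p.1).add ((Real.hasDerivAt_sin t).smul_const p.2)
    have h2 := ((hg.differentiable one_ne_zero
      (Real.cos t • p.1 + Real.sin t • p.2)).hasFDerivAt).comp_hasDerivAt t h1
    rw [fderiv_eq g hg] at h2
    exact (h2.const_mul _).mul_const _

lemma G'_eq {T : ℝ} (hT : 0 < T) {g : E → ℝ} (hg : ContDiff ℝ 1 g) (C : ℝ)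
    (hC : ∀ x, |g x| ≤ C) (hC' : ∀ x, ‖gradient g x‖ ≤ C) (θ : ℝ) :
    G' T g θ = (-Real.sin θ / (2 * T)) * ∫ p : E × E,
      inner ℝ (gradient g (Real.cos θ • p.1 - Real.sin θ • p.2)) (gradient g p.1) *
        (w T p.1 * w T p.2) := by
  have hC0 : 0 ≤ C := (abs_nonneg _).trans (hC 0)
  have gc := hg.continuous
  have Dc := grad_cont g hg
  have wc := w_cont (E := E) T
  have s1 : G' T g θ = ∫ p : E × E, (g (Real.cos θ • p.1 - Real.sin θ • p.2) *
      inner ℝ (gradient g p.1) p.2) * (w T p.1 * w T p.2) := by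
    rw [← rot_int θ, G']
    refine integral_congr_ae (Filter.Eventually.of_forall fun p => ?_)
    simp only
    rw [rot_w]
    congr 3
    have := Real.sin_sq_add_cos_sq θ
    have e : Real.cos θ • (Real.cos θ • p.1 + Real.sin θ • p.2) -
      Real.sin θ • (-Real.sin θ • p.1 + Real.cos θ • p.2) =
        (Real.sin θ ^ 2 + Real.cos θ ^ 2) • p.1 := by module
    rw [e, this, one_smul]
  have I1 : Integrable (fun p : E × E => (g (Real.cos θ • p.1 - Real.sin θ • p.2) *
      inner ℝ (gradient g p.1) p.2) * (w T p.1 * w T p.2)) := by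
    refine int2 hT (by fun_prop) (C * C) fun p => ?_
    rw [abs_mul]
    have h1 := abs_real_inner_le_norm (gradient g p.1) p.2
    calc _ ≤ C * (C * ‖p.2‖) := by
          refine mul_le_mul (hC _) (h1.trans ?_) (abs_nonneg _) hC0
          exact mul_le_mul_of_nonneg_right (hC' _) (norm_nonneg _)
      _ = (C * C) * ‖p.2‖ := by ring
      _ ≤ _ := by
          gcongr
          nlinarith [mul_nonneg (norm_nonneg p.1) (norm_nonneg p.2), norm_nonneg p.1]
  have I2 : Integrable (fun p : E × E =>
      inner ℝ (gradient g (Real.cos θ • p.1 - Real.sin θ • p.2)) (gradient g p.1) *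
        (w T p.1 * w T p.2)) := by
    refine int2 hT (by fun_prop) (C * C) fun p => ?_
    refine le_trans ?_ (one_le_bd (mul_nonneg hC0 hC0))
    exact (abs_real_inner_le_norm _ _).trans
      (mul_le_mul (hC' _) (hC' _) (norm_nonneg _) hC0)
  rw [s1, Measure.volume_eq_prod, integral_prod _ I1, integral_prod _ I2, ← integral_const_mul]
  refine integral_congr_ae (Filter.Eventually.of_forall fun u => ?_)
  simp only
  have hh : ContDiff ℝ 1 fun v : E => g (Real.cos θ • u - Real.sin θ • v) :=
    hg.comp (by fun_prop)
  have fd : ∀ v, HasFDerivAt (fun v : E => g (Real.cos θ • u - Real.sin θ • v))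
      ((-Real.sin θ) • fderiv ℝ g (Real.cos θ • u - Real.sin θ • v)) v := by
    intro v
    have h1 : HasFDerivAt (fun v : E => Real.cos θ • u - Real.sin θ • v)
        ((-Real.sin θ) • ContinuousLinearMap.id ℝ E) v := by
      have := ((hasFDerivAt_id (𝕜 := ℝ) v).const_smul (Real.sin θ)).const_sub (Real.cos θ • u)
      rw [neg_smul]
      exact this
    have h2 := ((hg.differentiable one_ne_zero
      (Real.cos θ • u - Real.sin θ • v)).hasFDerivAt).comp v h1
    have e : (-Real.sin θ) • fderiv ℝ g (Real.cos θ • u - Real.sin θ • v) =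
        (fderiv ℝ g (Real.cos θ • u - Real.sin θ • v)).comp
          ((-Real.sin θ) • ContinuousLinearMap.id ℝ E) := by
      ext z
      simp
    rw [e]
    exact h2
  have key := ibp hT hh C (fun v => hC _) (fun v => by
    rw [(fd v).fderiv, norm_smul, norm_neg]
    have : ‖fderiv ℝ g (Real.cos θ • u - Real.sin θ • v)‖ ≤ C := by
      have := hC' (Real.cos θ • u - Real.sin θ • v)
      rwa [gradient, LinearIsometryEquiv.norm_map] at this
    calc _ ≤ 1 * C := mul_le_mul (Real.abs_sin_le_one θ) this (norm_nonneg _) zero_le_one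
      _ = C := one_mul C) (gradient g u)
  calc _ = w T u * ∫ v, g (Real.cos θ • u - Real.sin θ • v) * inner ℝ (gradient g u) v * w T v := by
        rw [← integral_const_mul]
        congr 1; ext v; ring
    _ = _ := by
        rw [key, ← integral_const_mul, ← integral_const_mul, ← integral_const_mul]
        congr 1; ext v
        rw [(fd v).fderiv, ContinuousLinearMap.smul_apply, fderiv_eq g hg, smul_eq_mul]
        ring

lemma prod_w (T : ℝ) (φ ψ : E → ℝ) :
    ∫ p : E × E, (φ p.1 * ψ p.2) * (w T p.1 * w T p.2) =
      (∫ x, φ x * w T x) * ∫ x, ψ x * w T x := by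
  rw [← integral_prod_mul, Measure.volume_eq_prod]
  congr 1; ext p; ring

lemma inner_le {T : ℝ} (hT : 0 < T) {g : E → ℝ} (hg : ContDiff ℝ 1 g) (C : ℝ)
    (hC' : ∀ x, ‖gradient g x‖ ≤ C) (θ : ℝ) :
    ∫ p : E × E,
      inner ℝ (gradient g (Real.cos θ • p.1 - Real.sin θ • p.2)) (gradient g p.1) *
        (w T p.1 * w T p.2) ≤ (∫ x, ‖gradient g x‖ ^ 2 * w T x) * ∫ x : E, w T x := by
  have hC0 : 0 ≤ C := (norm_nonneg _).trans (hC' 0)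
  have Dc := grad_cont g hg
  have I2 : Integrable (fun p : E × E =>
      inner ℝ (gradient g (Real.cos θ • p.1 - Real.sin θ • p.2)) (gradient g p.1) *
        (w T p.1 * w T p.2)) := by
    refine int2 hT (by fun_prop) (C * C) fun p => ?_
    refine le_trans ?_ (one_le_bd (mul_nonneg hC0 hC0))
    exact (abs_real_inner_le_norm _ _).trans
      (mul_le_mul (hC' _) (hC' _) (norm_nonneg _) hC0)
  have I3 : Integrable (fun p : E × E =>
      ‖gradient g (Real.cos θ • p.1 - Real.sin θ • p.2)‖ ^ 2 * (w T p.1 * w T p.2)) := by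
    refine int2 hT (by fun_prop) (C * C) fun p => ?_
    refine le_trans ?_ (one_le_bd (mul_nonneg hC0 hC0))
    rw [abs_of_nonneg (sq_nonneg _), sq]
    exact (mul_le_mul (hC' _) (hC' _) (norm_nonneg _) hC0)
  have I4 : Integrable (fun p : E × E =>
      ‖gradient g p.1‖ ^ 2 * (w T p.1 * w T p.2)) := by
    refine int2 hT (by fun_prop) (C * C) fun p => ?_
    refine le_trans ?_ (one_le_bd (mul_nonneg hC0 hC0))
    rw [abs_of_nonneg (sq_nonneg _), sq]
    exact (mul_le_mul (hC' _) (hC' _) (norm_nonneg _) hC0)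
  have e4 : ∫ p : E × E, ‖gradient g p.1‖ ^ 2 * (w T p.1 * w T p.2) =
      (∫ x, ‖gradient g x‖ ^ 2 * w T x) * ∫ x : E, w T x := by
    have := prod_w (E := E) T (fun x => ‖gradient g x‖ ^ 2) (fun _ => 1)
    simpa using this
  have e3 : ∫ p : E × E, ‖gradient g (Real.cos θ • p.1 - Real.sin θ • p.2)‖ ^ 2 *
      (w T p.1 * w T p.2) = (∫ x, ‖gradient g x‖ ^ 2 * w T x) * ∫ x : E, w T x := by
    rw [← e4, ← rot_int (-θ) (fun p : E × E => ‖gradient g p.1‖ ^ 2 * (w T p.1 * w T p.2))]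
    refine integral_congr_ae (Filter.Eventually.of_forall fun p => ?_)
    simp only
    rw [rot_w]
    simp [sub_eq_add_neg]
  calc _ ≤ ∫ p : E × E, ((1 / 2) * (‖gradient g (Real.cos θ • p.1 - Real.sin θ • p.2)‖ ^ 2 *
      (w T p.1 * w T p.2)) + (1 / 2) * (‖gradient g p.1‖ ^ 2 * (w T p.1 * w T p.2))) := by
        refine integral_mono I2 ((I3.const_mul _).add (I4.const_mul _)) fun p => ?_
        simp only
        have h0 := mul_pos (w_pos T p.1) (w_pos T p.2)
        have h1 := real_inner_le_norm (gradient g (Real.cos θ • p.1 - Real.sin θ • p.2))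
          (gradient g p.1)
        have h2 := two_mul_le_add_sq ‖gradient g (Real.cos θ • p.1 - Real.sin θ • p.2)‖
          ‖gradient g p.1‖
        have h3 : inner ℝ (gradient g (Real.cos θ • p.1 - Real.sin θ • p.2)) (gradient g p.1) ≤
          (1 / 2) * ‖gradient g (Real.cos θ • p.1 - Real.sin θ • p.2)‖ ^ 2 +
            (1 / 2) * ‖gradient g p.1‖ ^ 2 := by linarith
        calc _ ≤ _ := mul_le_mul_of_nonneg_right h3 h0.le
          _ = _ := by ring
    _ = _ := by
        rw [integral_add (I3.const_mul _) (I4.const_mul _), integral_const_mul,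
          integral_const_mul, e3, e4]
        ring

theorem poincare {T : ℝ} (hT : 0 < T) {g : E → ℝ} (hg : ContDiff ℝ 1 g)
    (hs : HasCompactSupport g) (h0 : ∫ x, g x * w T x = 0) :
    2 * T * ∫ x, g x ^ 2 * w T x ≤ ∫ x, ‖gradient g x‖ ^ 2 * w T x := by
  obtain ⟨C1, hC1⟩ := hs.exists_bound_of_continuous hg.continuous
  obtain ⟨C2, hC2⟩ := (grad_supp g hs).exists_bound_of_continuous (grad_cont g hg)
  have hC : ∀ x, |g x| ≤ max C1 C2 := fun x => (hC1 x).trans (le_max_left _ _)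
  have hC' : ∀ x, ‖gradient g x‖ ≤ max C1 C2 := fun x => (hC2 x).trans (le_max_right _ _)
  generalize max C1 C2 = C at hC hC'
  have hW := W_pos (E := E) hT
  set W := ∫ x : E, w T x with hWd
  set A := ∫ x, ‖gradient g x‖ ^ 2 * w T x with hA
  let H : ℝ → ℝ := fun θ => G T g θ - Real.cos θ * (A * W / (2 * T))
  have hH : ∀ θ, HasDerivAt H (G' T g θ - -Real.sin θ * (A * W / (2 * T))) θ := fun θ =>
    (G_deriv hT hg C hC hC' θ).sub ((Real.hasDerivAt_cos θ).mul_const _)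
  have hmono : MonotoneOn H (Set.Icc 0 (Real.pi / 2)) := by
    refine monotoneOn_of_hasDerivWithinAt_nonneg (convex_Icc _ _)
      (fun x _ => (hH x).continuousAt.continuousWithinAt)
      (fun x _ => (hH x).hasDerivWithinAt) fun θ hθ => ?_
    have hθ' := interior_subset hθ
    have hsin : 0 ≤ Real.sin θ :=
      Real.sin_nonneg_of_nonneg_of_le_pi hθ'.1 (by linarith [hθ'.2, Real.pi_pos])
    rw [G'_eq hT hg C hC hC' θ]
    have hi := inner_le hT hg C hC' θ
    have hst : 0 ≤ Real.sin θ / (2 * T) := by positivity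
    have := mul_le_mul_of_nonneg_left hi hst
    rw [← hA, ← hWd] at this
    have e : Real.sin θ * (A * W / (2 * T)) = Real.sin θ / (2 * T) * (A * W) := by ring
    rw [neg_div, neg_mul, neg_mul, e]
    linarith
  have hp := Real.pi_pos
  have hle := hmono (Set.left_mem_Icc.2 (by linarith)) (Set.right_mem_Icc.2 (by linarith))
    (by linarith : (0 : ℝ) ≤ Real.pi / 2)
  have g0 : G T g 0 = (∫ x, g x ^ 2 * w T x) * W := by
    have := prod_w (E := E) T (fun x => g x ^ 2) (fun _ => 1)
    simp only [one_mul, mul_one] at this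
    rw [hWd, ← this]
    simp [G, sq]
  have g1 : G T g (Real.pi / 2) = 0 := by
    have := prod_w (E := E) T g g
    rw [h0, zero_mul] at this
    simpa [G] using this
  simp only [H, g0, g1, Real.cos_zero, Real.cos_pi_div_two] at hle
  have h5 : (∫ x, g x ^ 2 * w T x) * W ≤ A * W / (2 * T) := by linarith
  rw [le_div_iff₀ (by positivity)] at h5
  have h6 : (2 * T * ∫ x, g x ^ 2 * w T x) * W ≤ A * W := by linarith
  exact le_of_mul_le_mul_right h6 hW

lemma div_coord {f : E → ℝ} (hf : ContDiff ℝ 1 f) (hs : HasCompactSupport f) (p : E)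
    (hp : ‖p‖ = 1) :
    ∫ x, 2 * f x * (inner ℝ p x * inner ℝ (gradient f x) p) = - ∫ x, f x ^ 2 := by
  have fc := hf.continuous
  have Dc := grad_cont f hf
  have f2 : ContDiff ℝ 1 fun x => f x ^ 2 := hf.pow 2
  have fd : ∀ x, fderiv ℝ (fun x => f x ^ 2) x p = 2 * f x * inner ℝ (gradient f x) p := by
    intro x
    have h := ((hf.differentiable one_ne_zero x).hasFDerivAt).pow 2
    rw [h.fderiv, ← fderiv_eq f hf]
    simp
  have fi : ∀ x, HasFDerivAt (fun x : E => inner ℝ p x) (innerSL ℝ p) x :=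
    fun x => (innerSL ℝ p).hasFDerivAt
  have fi' : ∀ x, fderiv ℝ (fun x : E => inner ℝ p x) x p = 1 := by
    intro x; rw [(fi x).fderiv]; simp [hp]
  have key := integral_mul_fderiv_eq_neg_fderiv_mul_of_integrable (μ := (volume : Measure E))
    (f := fun x : E => inner ℝ p x) (g := fun x => f x ^ 2) (v := p) ?_ ?_ ?_
    (fun x _ => (fi x).differentiableAt)
    (fun x _ => (f2.differentiable one_ne_zero) x)
  · simp only [fi', fd, one_mul] at key
    rw [← key]
    congr 1; ext x; ring
  · simp only [fi', one_mul]
    refine Continuous.integrable_of_hasCompactSupport (by fun_prop) ?_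
    exact hs.comp_left (g := fun t : ℝ => t ^ 2) (by simp)
  · simp only [fd]
    refine Continuous.integrable_of_hasCompactSupport (by fun_prop) ?_
    exact ((hs.mul_left (f := fun _ => (2 : ℝ))).mul_right).mul_left
  · refine Continuous.integrable_of_hasCompactSupport (by fun_prop) ?_
    exact (hs.comp_left (g := fun t : ℝ => t ^ 2) (by simp)).mul_left

lemma div_thm {f : E → ℝ} (hf : ContDiff ℝ 1 f) (hs : HasCompactSupport f) :
    ∫ x, 2 * f x * inner ℝ (gradient f x) x = - (Module.finrank ℝ E * ∫ x, f x ^ 2) := by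
  have fc := hf.continuous
  have Dc := grad_cont f hf
  let b := stdOrthonormalBasis ℝ E
  have e : ∀ x, 2 * f x * inner ℝ (gradient f x) x =
      ∑ i, 2 * f x * (inner ℝ (b i) x * inner ℝ (gradient f x) (b i)) := by
    intro x
    rw [← Finset.mul_sum, ← b.sum_inner_mul_inner (gradient f x) x]
    congr 1
    exact Finset.sum_congr rfl fun i _ => mul_comm _ _
  simp only [e]
  rw [integral_finset_sum]
  · simp only [div_coord hf hs _ (b.norm_eq_one _)]
    simp
  · intro i _
    refine Continuous.integrable_of_hasCompactSupport (by fun_prop) ?_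
    exact ((hs.mul_left (f := fun _ => (2 : ℝ))).mul_right)

theorem main {T : ℝ} (hT : 0 < T) {f : E → ℝ} (hf : ContDiff ℝ 1 f)
    (hs : HasCompactSupport f) (h0 : ∫ x, f x * Real.exp (-T * ‖x‖ ^ 2 / 2) = 0) :
    ((Module.finrank ℝ E : ℝ) + 2) * T * ∫ x, f x ^ 2 ≤
      ∫ x, (‖gradient f x‖ ^ 2 + T ^ 2 * ‖x‖ ^ 2 * f x ^ 2) := by
  have fc := hf.continuous
  have Dc := grad_cont f hf
  let g : E → ℝ := fun x => f x * w (-(T / 2)) x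
  have hg : ContDiff ℝ 1 g := hf.mul (w_contDiff _)
  have hgs : HasCompactSupport g := hs.mul_right
  have hww : ∀ x : E, w (-(T / 2)) x * w (-(T / 2)) x * w T x = 1 := by
    intro x
    unfold w
    rw [← Real.exp_add, ← Real.exp_add, Real.exp_eq_one_iff]
    ring
  have hgr : ∀ x, gradient g x = w (-(T / 2)) x • (gradient f x + (T * f x) • x) := by
    intro x
    refine ext_inner_right ℝ fun v => ?_
    rw [← fderiv_eq g hg]
    have h := ((hf.differentiable one_ne_zero x).hasFDerivAt).mul (w_hasFDerivAt (-(T / 2)) x)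
    have h' : fderiv ℝ g x = _ := h.fderiv
    rw [h']
    simp only [ContinuousLinearMap.add_apply, ContinuousLinearMap.smul_apply, fderiv_eq f hf,
      smul_eq_mul, inner_smul_left, inner_add_left, innerSL_apply_apply, conj_trivial]
    ring
  have key := poincare hT hg hgs (by
    rw [← h0]
    congr 1; ext x
    simp only [g, w, mul_assoc]
    rw [← Real.exp_add]
    congr 2; ring)
  have e1 : ∀ x, g x ^ 2 * w T x = f x ^ 2 := by
    intro x
    simp only [g]
    linear_combination f x ^ 2 * hww x
  have e2 : ∀ x, ‖gradient g x‖ ^ 2 * w T x = (‖gradient f x‖ ^ 2 + T ^ 2 * ‖x‖ ^ 2 * f x ^ 2) +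
      T * (2 * f x * inner ℝ (gradient f x) x) := by
    intro x
    rw [hgr, norm_smul, mul_pow, norm_add_sq_real, Real.norm_eq_abs, sq_abs, norm_smul,
      inner_smul_right, mul_pow, Real.norm_eq_abs, sq_abs]
    linear_combination (‖gradient f x‖ ^ 2 + 2 * (T * f x * inner ℝ (gradient f x) x) +
      (T * f x) ^ 2 * ‖x‖ ^ 2) * hww x
  simp only [e1, e2] at key
  rw [integral_add, integral_const_mul, div_thm hf hs] at key
  · linarith
  · refine Integrable.add ?_ ?_
    · refine Continuous.integrable_of_hasCompactSupport (by fun_prop) ?_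
      exact (grad_supp f hs).comp_left (g := fun v : E => ‖v‖ ^ 2) (by simp)
    · refine Continuous.integrable_of_hasCompactSupport (by fun_prop) ?_
      exact (hs.comp_left (g := fun t : ℝ => t ^ 2) (by simp)).mul_left
  · refine Integrable.const_mul ?_ _
    refine Continuous.integrable_of_hasCompactSupport (by fun_prop) ?_
    exact ((hs.mul_left (f := fun _ => (2 : ℝ))).mul_right)

end HOGap



/-- Harmonic oscillator spectral gap: for `T > 0` and every smooth compactly supported
`f : ℝᵈ → ℝ` orthogonal to the Gaussian ground state `exp(−T‖Z‖²/2)`, one has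
`∫ (‖∇f(Z)‖² + T²·‖Z‖²·f(Z)²) dZ ≥ (d + 2)·T·∫ f(Z)² dZ`. -/
theorem harmonic_oscillator_spectral_gap (d : ℕ) (hd : 1 ≤ d) (T : ℝ) (hT : 0 < T)
    (f : EuclideanSpace ℝ (Fin d) → ℝ) (hf : ContDiff ℝ (⊤ : ℕ∞) f)
    (hsupp : HasCompactSupport f)
    (horth : ∫ Z : EuclideanSpace ℝ (Fin d), f Z * Real.exp (-T * ‖Z‖ ^ 2 / 2) = 0) :
    (d + 2) * T * ∫ Z : EuclideanSpace ℝ (Fin d), f Z ^ 2 ≤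
      ∫ Z : EuclideanSpace ℝ (Fin d),
        (‖gradient f Z‖ ^ 2 + T ^ 2 * ‖Z‖ ^ 2 * f Z ^ 2) := by
  have h := HOGap.main hT (hf.of_le (by exact_mod_cast le_top)) hsupp horth
  simpa using h
end
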